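/- arXiv:1610.06012 — 2 statements merged into one kernel-verified Lean document; each statement's English description precedes it below -/
import Mathlib

section
/- (Zero-padding invariant.) Let m ≥ 1, let V ∈ ℝ^c be a workload vector with V(1) = 0, and let W ∈ ℝ^{c+m} be the zero-padded vector with W(k) = 0 for 1 ≤ k ≤ m and W(k+m) = V(k) for 1 ≤ k ≤ c. Then for any S ≥ 0 and t ≥ 0, the updated vectors V̂ = step_{S,t}(V) and Ŵ = step_{S,t}(W) satisfy the same relation: Ŵ(k) = 0 for 1 ≤ k ≤ m and Ŵ(k+m) = V̂(k) for 1 ≤ k ≤ c. -/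
open scoped Classical

noncomputable section

/-- The `k`-th coordinate (0-based) of a vector in `ℝ^n`, defaulting to 0 out of range. -/
def coord {n : ℕ} (V : Fin n → ℝ) (k : ℕ) : ℝ :=
  if h : k < n then V ⟨k, h⟩ else 0

/-- A workload vector: coordinates nonnegative and in increasing order. -/
def IsWorkload {n : ℕ} (V : Fin n → ℝ) : Prop :=
  Monotone V ∧ ∀ i, 0 ≤ V i

/-- Add the service duration `S` to the minimal (first) coordinate. -/
def bump {n : ℕ} (S : ℝ) (V : Fin n → ℝ) : Fin n → ℝ :=
  fun i => if (i : ℕ) = 0 then V i + S else V i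

/-- The arrival step: increasing rearrangement of the vector obtained from `V`
by replacing its minimal coordinate `V(1)` by `V(1) + S`. -/
def arr {n : ℕ} (S : ℝ) (V : Fin n → ℝ) : Fin n → ℝ :=
  bump S V ∘ Tuple.sort (bump S V)

/-- The decay step: each coordinate decreases by `t`, truncated at 0. -/
def dec {n : ℕ} (t : ℝ) (V : Fin n → ℝ) : Fin n → ℝ :=
  fun i => max (V i - t) 0

/-- The Kiefer-Wolfowitz one-step update with service `S` and elapsed time `t`. -/
def step {n : ℕ} (S t : ℝ) (V : Fin n → ℝ) : Fin n → ℝ :=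
  dec t (arr S V)

/-- `kU S V` (1-based): the least `k ∈ {1,…,n−1}` with `V(1)+S ≤ V(k+1)`
(0-based: `coord V 0 + S ≤ coord V k`), and `n` if there is no such `k`. -/
def kU {n : ℕ} (S : ℝ) (V : Fin n → ℝ) : ℕ :=
  sInf ({k : ℕ | 1 ≤ k ∧ k < n ∧ coord V 0 + S ≤ coord V k} ∪ {n})

/-- `OrdDom V W` (i.e. `V ⊴ W`): each of the `c` busiest servers of `V ∈ ℝ^{c+m}`
has no more work than the corresponding server of `W ∈ ℝ^c`. -/
def OrdDom {c m : ℕ} (V : Fin (c + m) → ℝ) (W : Fin c → ℝ) : Prop :=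
  ∀ k : ℕ, k < c → coord V (k + m) ≤ coord W k

/-- The time-to-coalescence `C(L,U)`: equal to `U(n)` for
`n = max{k : L(k) ≠ U(k)}` when `L ≠ U`, and `0` when `L = U`. -/
def coalTime {n : ℕ} (L U : Fin n → ℝ) : ℝ :=
  if L = U then 0 else coord U (sSup {k : ℕ | k < n ∧ coord L k ≠ coord U k})

end

/-- The coordinates of a vector of length `c + m`, split into the first `m` and the last `c`. -/
def padEquiv (c m : ℕ) : Fin m ⊕ Fin c ≃ Fin (c + m) :=
  finSumFinEquiv.trans (finCongr (Nat.add_comm m c))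

theorem padEquiv_inl_val {c m : ℕ} (k : Fin m) : (padEquiv c m (Sum.inl k) : ℕ) = k := by
  simp [padEquiv]

theorem padEquiv_inr_val {c m : ℕ} (k : Fin c) : (padEquiv c m (Sum.inr k) : ℕ) = k + m := by
  simp [padEquiv, Nat.add_comm]

theorem coord_val {n : ℕ} (V : Fin n → ℝ) (i : Fin n) : coord V i = V i := by
  simp [coord]

theorem bump_nonneg {n : ℕ} {S : ℝ} (hS : 0 ≤ S) {V : Fin n → ℝ} (hV : ∀ i, 0 ≤ V i)
    (i : Fin n) : 0 ≤ bump S V i := by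
  unfold bump
  split_ifs
  · exact add_nonneg (hV _) hS
  · exact hV _

/-- A vector that is a permutation of the zero-padding of `f` rearranges increasingly to the
zero-padding of the increasing rearrangement of `f`, when `f` is nonnegative. -/
theorem comp_sort_padEquiv {c m : ℕ} {f : Fin c → ℝ} (hf : ∀ i, 0 ≤ f i)
    {g : Fin (c + m) → ℝ} {τ : Equiv.Perm (Fin (c + m))}
    (hg : ∀ x, g (τ (padEquiv c m x)) = Sum.elim (fun _ => 0) f x) (x : Fin m ⊕ Fin c) :
    (g ∘ Tuple.sort g) (padEquiv c m x) = Sum.elim (fun _ => 0) (f ∘ Tuple.sort f) x := by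
  let σ : Equiv.Perm (Fin (c + m)) := (padEquiv c m).symm.trans
    (((Equiv.refl _).sumCongr (Tuple.sort f)).trans ((padEquiv c m).trans τ))
  have hσ (x) : (g ∘ σ) (padEquiv c m x) = Sum.elim (fun _ => 0) (f ∘ Tuple.sort f) x := by
    rcases x with k | k <;> simp [σ, hg]
  have hmono : Monotone (g ∘ σ) := by
    intro i j hij
    obtain ⟨x, rfl⟩ := (padEquiv c m).surjective i
    obtain ⟨y, rfl⟩ := (padEquiv c m).surjective j
    rw [hσ, hσ]
    rw [Fin.le_def] at hij
    rcases x with k | k <;> rcases y with l | l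
    · exact le_rfl
    · exact hf _
    · rw [padEquiv_inl_val, padEquiv_inr_val] at hij
      omega
    · rw [padEquiv_inr_val, padEquiv_inr_val] at hij
      exact Tuple.monotone_sort f (Fin.le_def.2 (by omega))
  rw [Tuple.unique_monotone (Tuple.monotone_sort g) hmono, hσ]

/-- Exchanging the first and the `m`-th coordinate turns the bumped zero-padding of `V` into the
zero-padding of the bumped `V`. -/
theorem bump_swap_padEquiv {c m : ℕ} (hc : 1 ≤ c) (hm : 1 ≤ m)
    {V : Fin c → ℝ} (hV1 : coord V 0 = 0) {W : Fin (c + m) → ℝ}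
    (hWzero : ∀ k : Fin m, W (padEquiv c m (Sum.inl k)) = 0)
    (hWpad : ∀ k : Fin c, W (padEquiv c m (Sum.inr k)) = V k) (S : ℝ) (x : Fin m ⊕ Fin c) :
    bump S W (Equiv.swap (padEquiv c m (Sum.inl ⟨0, hm⟩)) (padEquiv c m (Sum.inr ⟨0, hc⟩))
      (padEquiv c m x)) = Sum.elim (fun _ => 0) (bump S V) x := by
  have hV0 : V ⟨0, hc⟩ = 0 := by rw [← coord_val V, hV1]
  rcases x with k | k
  · by_cases hk : k = ⟨0, hm⟩
    · subst hk
      rw [Equiv.swap_apply_left]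
      simp [bump, padEquiv_inr_val, hWpad, hV0, Nat.ne_of_gt hm]
    · have hk' : (k : ℕ) ≠ 0 := fun h => hk (Fin.ext h)
      rw [Equiv.swap_apply_of_ne_of_ne (by simpa using hk) (by simp)]
      simp [bump, padEquiv_inl_val, hWzero, hk']
  · by_cases hk : k = ⟨0, hc⟩
    · subst hk
      rw [Equiv.swap_apply_right]
      simp [bump, padEquiv_inl_val, hWzero, hV0]
    · have hk' : (k : ℕ) ≠ 0 := fun h => hk (Fin.ext h)
      rw [Equiv.swap_apply_of_ne_of_ne (by simp) (by simpa using hk)]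
      simp [bump, padEquiv_inr_val, hWpad, hk']

/-- zero-padding invariant: if `W ∈ ℝ^{c+m}` is the zero-padding of a
workload vector `V ∈ ℝ^c` with `V(1) = 0`, then `step S t W` is the zero-padding of
`step S t V`. -/
theorem stmt9 {c m : ℕ} (hc : 1 ≤ c) (hm : 1 ≤ m)
    (V : Fin c → ℝ) (hV : IsWorkload V) (hV1 : coord V 0 = 0)
    (W : Fin (c + m) → ℝ)
    (hWzero : ∀ k : ℕ, k < m → coord W k = 0)
    (hWpad : ∀ k : ℕ, k < c → coord W (k + m) = coord V k)
    (S t : ℝ) (hS : 0 ≤ S) (ht : 0 ≤ t) :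
    (∀ k : ℕ, k < m → coord (step S t W) k = 0) ∧
    (∀ k : ℕ, k < c → coord (step S t W) (k + m) = coord (step S t V) k) := by
  have harr (x) : arr S W (padEquiv c m x) = Sum.elim (fun _ => 0) (arr S V) x :=
    comp_sort_padEquiv (bump_nonneg hS hV.2) (bump_swap_padEquiv hc hm hV1
      (fun k => by rw [← coord_val W, padEquiv_inl_val, hWzero k k.2])
      (fun k => by rw [← coord_val W, padEquiv_inr_val, hWpad k k.2, coord_val]) S) x
  refine ⟨fun k hk => ?_, fun k hk => ?_⟩
  · change coord (step S t W) (⟨k, hk⟩ : Fin m) = 0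
    rw [← padEquiv_inl_val (c := c), coord_val]
    simp [step, dec, harr, ht]
  · change coord (step S t W) ((⟨k, hk⟩ : Fin c) + m) = coord (step S t V) (⟨k, hk⟩ : Fin c)
    rw [← padEquiv_inr_val, coord_val, coord_val]
    simp [step, dec, harr]
end

section
/- (Proposition 3.4, discrete form.) Let m ≥ 1, let (S_n)_{n≥1} be service durations with S_n > 0 and (τ_n)_{n≥0} inter-arrival times with τ_n ≥ 0, and let U_0 ∈ ℝ^c be a workload vector. Define four processes as follows: U^c in ℝ^c starts at U_0; L^c in ℝ^c starts at the zero vector; U^{c+m} in ℝ^{c+m} starts at the zero-padding of U_0 (m zero coordinates followed by the coordinates of U_0); L^{c+m} in ℝ^{c+m} starts at the zero vector; and each process X evolves by the pre-arrival/post-arrival recursion X̃_n = dec_{τ_n}(X_n), X_{n+1} = arr_{S_{n+1}}(X̃_n). Let N ≥ 0 and suppose that L̃^c_n(1) = 0 for every n ≤ N (the lower c-server process always has an idle server just before each arrival), and that L̃^c_N = Ũ^c_N. Then L̃^{c+m}_N = Ũ^{c+m}_N; that is, coalescence of the c-server sandwiching processes implies coalescence of the (c+m)-server sandwiching processes by the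 same time. -/
open scoped Classical

theorem coord_of_lt {n : ℕ} (V : Fin n → ℝ) {k : ℕ} (h : k < n) : coord V k = V ⟨k, h⟩ := by
  simp [coord, h]

theorem coord_bump_zero {n : ℕ} (hn : 0 < n) (S : ℝ) (V : Fin n → ℝ) :
    coord (bump S V) 0 = coord V 0 + S := by
  simp [coord, bump, hn]

theorem coord_bump_of_ne_zero {n : ℕ} (S : ℝ) (V : Fin n → ℝ) {k : ℕ} (hk : k ≠ 0) :
    coord (bump S V) k = coord V k := by
  simp [coord, bump, hk]

theorem coord_dec {n : ℕ} (t : ℝ) (V : Fin n → ℝ) {k : ℕ} (h : k < n) :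
    coord (dec t V) k = max (coord V k - t) 0 := by
  simp [coord, dec, h]

theorem coord_dec_le_coord_dec {n p : ℕ} (t : ℝ) {V : Fin n → ℝ} {W : Fin p → ℝ} {j k : ℕ}
    (hj : j < n) (hk : k < p) (h : coord V j ≤ coord W k) :
    coord (dec t V) j ≤ coord (dec t W) k := by
  rw [coord_dec t V hj, coord_dec t W hk]
  gcongr

theorem coord_dec_nonneg {n : ℕ} (t : ℝ) (V : Fin n → ℝ) (k : ℕ) : 0 ≤ coord (dec t V) k := by
  unfold coord dec
  split_ifs <;> simp

theorem Monotone.coord_le {n : ℕ} {V : Fin n → ℝ} (hV : Monotone V) {j k : ℕ} (hjk : j ≤ k)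
    (hk : k < n) : coord V j ≤ coord V k := by
  rw [coord_of_lt V hk, coord_of_lt V (hjk.trans_lt hk)]
  exact hV hjk

theorem Monotone.dec {n : ℕ} {V : Fin n → ℝ} (hV : Monotone V) (t : ℝ) : Monotone (dec t V) := by
  intro i j hij
  have := hV hij
  unfold _root_.dec
  gcongr

theorem monotone_arr {n : ℕ} (S : ℝ) (V : Fin n → ℝ) : Monotone (arr S V) :=
  Tuple.monotone_sort _

/-- A coordinate of the post-arrival vector is at most `x` iff enough coordinates of the
unsorted vector are. -/
theorem coord_arr_le_iff {n : ℕ} (S : ℝ) (V : Fin n → ℝ) {k : ℕ} (hk : k < n) (x : ℝ) :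
    coord (arr S V) k ≤ x ↔
      k < ((Finset.range n).filter fun j => coord (bump S V) j ≤ x).card := by
  rw [coord_of_lt _ hk, ← Tuple.lt_card_le_iff_apply_le_of_monotone (monotone_arr S V)]
  have h₁ : (Finset.univ.filter fun i => arr S V i ≤ x).card =
      (Finset.univ.filter fun i => bump S V i ≤ x).card :=
    Finset.card_equiv (Tuple.sort (bump S V)) fun i => by
      simp only [Finset.mem_filter_univ]
      rfl
  have h₂ : (Finset.univ.filter fun i => bump S V i ≤ x).card =
      ((Finset.range n).filter fun j => coord (bump S V) j ≤ x).card := by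
    refine Finset.card_bij (fun i _ => (i : ℕ)) ?_ ?_ ?_
    · intro i hi
      simpa [coord_of_lt _ i.isLt] using hi
    · intro i _ j _ hij
      exact Fin.ext hij
    · intro j hj
      simp only [Finset.mem_filter, Finset.mem_range] at hj
      refine ⟨⟨j, hj.1⟩, ?_, rfl⟩
      simpa [coord_of_lt _ hj.1] using hj.2
  rw [h₁, h₂]

/-- The embedding of server indices that fixes the minimal one and shifts the others by `m`. -/
def shiftPos (m j : ℕ) : ℕ := if j = 0 then 0 else j + m

theorem shiftPos_injective (m : ℕ) : Function.Injective (shiftPos m) := by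
  intro i j h
  unfold shiftPos at h
  split_ifs at h <;> omega

theorem card_image_shiftPos_union (m : ℕ) (s : Finset ℕ) :
    (s.image (shiftPos m) ∪ Finset.Icc 1 m).card = s.card + m := by
  rw [Finset.card_union_of_disjoint, Finset.card_image_of_injective _ (shiftPos_injective m)]
  · simp
  · rw [Finset.disjoint_left]
    intro i hi hi'
    obtain ⟨j, -, rfl⟩ := Finset.mem_image.1 hi
    rw [Finset.mem_Icc] at hi'
    unfold shiftPos at hi'
    split_ifs at hi' <;> omega

theorem OrdDom.dec {c m : ℕ} {V : Fin (c + m) → ℝ} {W : Fin c → ℝ} (h : OrdDom V W) (t : ℝ) :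
    OrdDom (dec t V) (dec t W) := fun k hk =>
  coord_dec_le_coord_dec t (by omega) hk (h k hk)

/-- The order `⊴` is preserved by simultaneous arrivals. -/
theorem OrdDom.arr {c m : ℕ} {S : ℝ} (hS : 0 ≤ S) {V : Fin (c + m) → ℝ} {W : Fin c → ℝ}
    (hV : Monotone V) (hW : Monotone W) (h : OrdDom V W) : OrdDom (arr S V) (arr S W) := by
  intro k hk
  have hc : 0 < c := by omega
  have hcard := (coord_arr_le_iff S W hk _).1 le_rfl
  rw [coord_arr_le_iff S V (by omega)]
  set x := coord (_root_.arr S W) k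
  have hW₀ : coord W 0 ≤ x := by
    obtain ⟨j, hj⟩ := Finset.card_pos.1 ((Nat.zero_le k).trans_lt hcard)
    simp only [Finset.mem_filter, Finset.mem_range] at hj
    rcases eq_or_ne j 0 with rfl | hj₀
    · rw [coord_bump_zero hc] at hj
      linarith [hj.2]
    · rw [coord_bump_of_ne_zero S W hj₀] at hj
      exact (hW.coord_le (Nat.zero_le j) hj.1).trans hj.2
  have hVm : coord V m ≤ coord W 0 := by simpa using h 0 hc
  have hsub : ((Finset.range c).filter fun j => coord (bump S W) j ≤ x).image (shiftPos m) ∪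
      Finset.Icc 1 m ⊆ (Finset.range (c + m)).filter fun j => coord (bump S V) j ≤ x := by
    intro i hi
    simp only [Finset.mem_filter, Finset.mem_range]
    rcases Finset.mem_union.1 hi with hi | hi
    · obtain ⟨j, hj, rfl⟩ := Finset.mem_image.1 hi
      simp only [Finset.mem_filter, Finset.mem_range] at hj
      rcases eq_or_ne j 0 with rfl | hj₀
      · rw [coord_bump_zero hc] at hj
        simp only [shiftPos, if_true]
        rw [coord_bump_zero (by omega)]
        refine ⟨by omega, ?_⟩
        linarith [hj.2, hV.coord_le (Nat.zero_le m) (by omega)]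
      · rw [coord_bump_of_ne_zero S W hj₀] at hj
        simp only [shiftPos, if_neg hj₀]
        rw [coord_bump_of_ne_zero S V (by omega)]
        exact ⟨by omega, (h j hj.1).trans hj.2⟩
    · rw [Finset.mem_Icc] at hi
      rw [coord_bump_of_ne_zero S V (by omega)]
      exact ⟨by omega, ((hV.coord_le hi.2 (by omega)).trans hVm).trans hW₀⟩
  have := Finset.card_le_card hsub
  rw [card_image_shiftPos_union] at this
  omega

/-- If the smaller system has an idle server, an arrival preserves the property that its servers
are dominated by the busiest servers of the larger system. -/
theorem coord_arr_le_coord_arr_of_idle {c m : ℕ} (S : ℝ) {V : Fin (c + m) → ℝ} {W : Fin c → ℝ}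
    (hW₀ : coord W 0 = 0) (hV₀ : 0 ≤ coord V 0)
    (h : ∀ k < c, coord W k ≤ coord V (k + m)) :
    ∀ k < c, coord (arr S W) k ≤ coord (arr S V) (k + m) := by
  intro k hk
  have hc : 0 < c := by omega
  have hcard := (coord_arr_le_iff S V (k := k + m) (by omega) _).1 le_rfl
  rw [coord_arr_le_iff S W hk]
  set x := coord (arr S V) (k + m)
  have hsub : (Finset.range (c + m)).filter (fun j => coord (bump S V) j ≤ x) ⊆
      ((Finset.range c).filter fun j => coord (bump S W) j ≤ x).image (shiftPos m) ∪
        Finset.Icc 1 m := by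
    intro i hi
    simp only [Finset.mem_filter, Finset.mem_range] at hi
    rw [Finset.mem_union, Finset.mem_Icc, Finset.mem_image]
    rcases eq_or_ne i 0 with rfl | hi₀
    · rw [coord_bump_zero (by omega)] at hi
      refine Or.inl ⟨0, ?_, by simp [shiftPos]⟩
      simp only [Finset.mem_filter, Finset.mem_range]
      rw [coord_bump_zero hc]
      exact ⟨hc, by linarith [hi.2]⟩
    · by_cases him : i ≤ m
      · exact Or.inr ⟨by omega, him⟩
      · rw [coord_bump_of_ne_zero S V hi₀] at hi
        have hne : i - m ≠ 0 := by omega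
        have hadd : i - m + m = i := by omega
        refine Or.inl ⟨i - m, ?_, by simp only [shiftPos, if_neg hne, hadd]⟩
        simp only [Finset.mem_filter, Finset.mem_range]
        rw [coord_bump_of_ne_zero S W hne]
        have := h (i - m) (by omega)
        rw [hadd] at this
        exact ⟨by omega, this.trans hi.2⟩
  have := Finset.card_le_card hsub
  rw [card_image_shiftPos_union] at this
  omega

/-- Proposition 3.4, discrete form: if the lower `c`-server process
always has an idle server just before each arrival up to time `N`, and the `c`-server
sandwiching processes have coalesced by time `N`, then so have the `(c+m)`-server
sandwiching processes. -/
theorem stmt11 {c m : ℕ} (hc : 1 ≤ c) (hm : 1 ≤ m)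
    (S τ : ℕ → ℝ) (hS : ∀ n, 0 < S n) (hτ : ∀ n, 0 ≤ τ n)
    (U0 : Fin c → ℝ) (hU0 : IsWorkload U0)
    (Uc Lc : ℕ → Fin c → ℝ) (Ucm Lcm : ℕ → Fin (c + m) → ℝ)
    (hUc0 : Uc 0 = U0)
    (hLc0 : Lc 0 = fun _ => 0)
    (hUcm0zero : ∀ k : ℕ, k < m → coord (Ucm 0) k = 0)
    (hUcm0pad : ∀ k : ℕ, k < c → coord (Ucm 0) (k + m) = coord U0 k)
    (hLcm0 : Lcm 0 = fun _ => 0)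
    (hUc : ∀ n, Uc (n + 1) = arr (S (n + 1)) (dec (τ n) (Uc n)))
    (hLc : ∀ n, Lc (n + 1) = arr (S (n + 1)) (dec (τ n) (Lc n)))
    (hUcm : ∀ n, Ucm (n + 1) = arr (S (n + 1)) (dec (τ n) (Ucm n)))
    (hLcm : ∀ n, Lcm (n + 1) = arr (S (n + 1)) (dec (τ n) (Lcm n)))
    (N : ℕ)
    (hidle : ∀ n ≤ N, coord (dec (τ n) (Lc n)) 0 = 0)
    (hcoal : dec (τ N) (Lc N) = dec (τ N) (Uc N)) :
    dec (τ N) (Lcm N) = dec (τ N) (Ucm N) := by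
  have coord_zero : ∀ {n : ℕ} (k : ℕ), coord (fun _ : Fin n => (0 : ℝ)) k = 0 := by
    intro n k
    simp [coord]
  have hU0nonneg : ∀ k < c, 0 ≤ coord U0 k := fun k hk => by
    rw [coord_of_lt U0 hk]
    exact hU0.2 _
  have hUcm0nonneg : ∀ k < c + m, 0 ≤ coord (Ucm 0) k := fun k hk => by
    by_cases hkm : k < m
    · exact (hUcm0zero k hkm).ge
    · obtain ⟨j, rfl⟩ := Nat.exists_eq_add_of_le' (not_lt.1 hkm)
      rw [hUcm0pad j (by omega)]
      exact hU0nonneg j (by omega)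
  have hUcm0mono : Monotone (Ucm 0) := by
    intro i j hij
    rw [← coord_of_lt (Ucm 0) i.isLt, ← coord_of_lt (Ucm 0) j.isLt]
    have hj := j.isLt
    have hij' : (i : ℕ) ≤ j := hij
    by_cases him : (i : ℕ) < m
    · rw [hUcm0zero _ him]
      exact hUcm0nonneg _ hj
    · obtain ⟨p, hp⟩ := Nat.exists_eq_add_of_le' (not_lt.1 him)
      obtain ⟨q, hq⟩ := Nat.exists_eq_add_of_le' ((not_lt.1 him).trans hij')
      rw [hp, hq, hUcm0pad p (by omega), hUcm0pad q (by omega)]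
      exact hU0.1.coord_le (by omega) (by omega)
  have hUcMono : ∀ n, Monotone (Uc n) := by
    rintro (_ | n)
    · exact hUc0 ▸ hU0.1
    · exact hUc n ▸ monotone_arr _ _
  have hUcmMono : ∀ n, Monotone (Ucm n) := by
    rintro (_ | n)
    · exact hUcm0mono
    · exact hUcm n ▸ monotone_arr _ _
  have hLcmMono : ∀ n, Monotone (Lcm n) := by
    rintro (_ | n)
    · exact hLcm0 ▸ monotone_const
    · exact hLcm n ▸ monotone_arr _ _
  have hUU : ∀ n, OrdDom (Ucm n) (Uc n) := by
    intro n
    induction n with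
    | zero => exact fun k hk => by rw [hUcm0pad k hk, hUc0]
    | succ n ih =>
      rw [hUcm, hUc]
      exact (ih.dec _).arr (hS _).le ((hUcmMono n).dec _) ((hUcMono n).dec _)
  have hLU : ∀ n, OrdDom (c := c + m) (m := 0) (Lcm n) (Ucm n) := by
    intro n
    induction n with
    | zero =>
      intro k hk
      rw [hLcm0]
      exact (coord_zero _).trans_le (hUcm0nonneg k hk)
    | succ n ih =>
      rw [hLcm, hUcm]
      exact (ih.dec _).arr (hS _).le ((hLcmMono n).dec _) ((hUcmMono n).dec _)
  have hLL : ∀ n ≤ N, ∀ k < c, coord (Lc n) k ≤ coord (Lcm n) (k + m) := by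
    intro n
    induction n with
    | zero =>
      intro _ k _
      rw [hLc0, hLcm0, coord_zero, coord_zero]
    | succ n ih =>
      intro hn
      rw [hLc, hLcm]
      exact coord_arr_le_coord_arr_of_idle _ (hidle n (by omega)) (coord_dec_nonneg _ _ _)
        fun k hk => coord_dec_le_coord_dec _ hk (by omega) (ih (by omega) k hk)
  have hUUN := (hUU N).dec (τ N)
  funext i
  have hi := i.isLt
  rw [← coord_of_lt (dec (τ N) (Lcm N)) hi, ← coord_of_lt (dec (τ N) (Ucm N)) hi]
  refine le_antisymm ((hLU N).dec (τ N) i hi) ?_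
  by_cases him : (i : ℕ) < m
  · have h₁ := ((hUcmMono N).dec (τ N)).coord_le him.le (by omega)
    have h₂ := hUUN 0 hc
    rw [Nat.zero_add, ← hcoal, hidle N le_rfl] at h₂
    exact (h₁.trans h₂).trans (coord_dec_nonneg _ _ _)
  · obtain ⟨k, hk⟩ := Nat.exists_eq_add_of_le' (not_lt.1 him)
    rw [hk]
    have h₁ := hUUN k (by omega)
    rw [← hcoal] at h₁
    exact h₁.trans (coord_dec_le_coord_dec _ (by omega) (by omega) (hLL N le_rfl k (by omega)))
end
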